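/- arXiv:2405.06163 — 2 statements merged into one kernel-verified Lean document; each statement's English description precedes it below -/
import Mathlib

section
/- J_2 is a prime ideal of k[x_1,…,x_m, y_1,…,y_m], and the quotient ring k[x_1,…,x_m, y_1,…,y_m]/J_2 has Krull dimension m. (This is the assertion that the third irreducible component V(J_2) of the special fiber of the chart of the splitting model is irreducible of dimension m = n − 2ℓ.) -/
/-!
STATEMENT 4: `J₂` is a prime ideal of `k[x₁,…,xₘ,y₁,…,yₘ]` and the quotient ring has Krull
dimension `m` (the third irreducible component `V(J₂)` of the special fiber of the chart of the
splitting model is irreducible of dimension `m = n − 2ℓ`). Here `k` is algebraically closed of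
characteristic ≠ 2.
-/

open MvPolynomial

/-- The `x`-variables. -/
noncomputable def xVar {m : ℕ} (k : Type*) [CommRing k] (i : Fin m) :
    MvPolynomial (Fin m ⊕ Fin m) k := X (Sum.inl i)

/-- The `y`-variables. -/
noncomputable def yVar {m : ℕ} (k : Type*) [CommRing k] (i : Fin m) :
    MvPolynomial (Fin m ⊕ Fin m) k := X (Sum.inr i)

/-- The ideal `J₂`, generated by the 2×2 minors `xᵢyⱼ − xⱼyᵢ` for `i < j` together with
`Σᵢ xᵢ y_{m+1−i}`, `Σᵢ xᵢ x_{m+1−i}` and `Σᵢ yᵢ y_{m+1−i}` (here `Fin.rev` realizes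
`i ↦ m+1−i` in 0-indexing). -/
noncomputable def J2Ideal (k : Type*) [CommRing k] (m : ℕ) :
    Ideal (MvPolynomial (Fin m ⊕ Fin m) k) :=
  Ideal.span
    ({p | ∃ i j : Fin m, i < j ∧ p = xVar k i * yVar k j - xVar k j * yVar k i} ∪
      {∑ i : Fin m, xVar k i * yVar k i.rev} ∪
      {∑ i : Fin m, xVar k i * xVar k i.rev} ∪
      {∑ i : Fin m, yVar k i * yVar k i.rev})

/-- An injective integral extension preserves the Krull dimension. -/
theorem ringKrullDim_eq_of_isIntegral (A B : Type*) [CommRing A] [CommRing B] [Algebra A B]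
    [FaithfulSMul A B] [Algebra.IsIntegral A B] : ringKrullDim B = ringKrullDim A := by
  apply le_antisymm
  · refine Order.krullDim_le_of_strictMono (PrimeSpectrum.comap (algebraMap A B)) fun P Q h ↦ ?_
    exact Ideal.IsIntegral.comap_lt_comap (R := A) (I := P.asIdeal) (J := Q.asIdeal) h
  · refine iSup_le fun l ↦ ?_
    obtain ⟨P, -, hP, hPl⟩ := Ideal.exists_ideal_over_prime_of_isIntegral
      (S := B) l.head.asIdeal ⊥ (by
        rw [← RingHom.ker_eq_comap_bot,
          (RingHom.injective_iff_ker_eq_bot _).mp (FaithfulSMul.algebraMap_injective A B)]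
        exact bot_le)
    have : P.LiesOver (RelSeries.head l).asIdeal := ⟨hPl.symm⟩
    obtain ⟨L, hL, -⟩ := Ideal.exists_ltSeries_of_hasGoingUp l P
    exact hL ▸ le_iSup (fun p : LTSeries (PrimeSpectrum B) ↦ (p.length : WithBot ℕ∞)) L

/-- The Krull dimension of an affine domain is its transcendence degree. -/
theorem IsTranscendenceBasis.ringKrullDim_eq {k R ι : Type*} [Field k] [CommRing R] [IsDomain R]
    [Algebra k R] [Algebra.FiniteType k R] [Finite ι] {x : ι → R}
    (hx : IsTranscendenceBasis k x) : ringKrullDim R = Nat.card ι := by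
  obtain ⟨s, g, hg, hint⟩ := exists_integral_inj_algHom_of_fg k R
  algebraize [g.toRingHom]
  have : FaithfulSMul (MvPolynomial (Fin s) k) R :=
    (faithfulSMul_iff_algebraMap_injective _ _).mpr hg
  have : IsScalarTower k (MvPolynomial (Fin s) k) R := .of_algHom g
  rw [ringKrullDim_eq_of_isIntegral (MvPolynomial (Fin s) k) R,
    MvPolynomial.ringKrullDim_of_isNoetherianRing]
  have h := lift_trdeg_add_eq k (MvPolynomial (Fin s) k) R
  rw [MvPolynomial.trdeg_of_isDomain, trdeg_eq_zero] at h
  have hs : s = Nat.card ι := by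
    have hsR := congrArg Cardinal.toNat h
    have hιR := congrArg Cardinal.toNat hx.lift_cardinalMk_eq_trdeg
    simp only [Cardinal.mk_fintype, Fintype.card_fin, Cardinal.lift_natCast, Cardinal.lift_zero,
      add_zero, Cardinal.toNat_natCast, Cardinal.toNat_lift] at hsR hιR
    exact hsR.trans hιR.symm
  simp [hs]

section Bimonomial
variable {ι R : Type*} [CommRing R]

/-- The monomial `x ^ a * y ^ b`. -/
noncomputable def bimonomial (x y : ι → R) (a b : ι →₀ ℕ) : R :=
  (a.prod fun i n ↦ x i ^ n) * b.prod fun i n ↦ y i ^ n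

variable {x y : ι → R}

theorem bimonomial_add (a a' b b' : ι →₀ ℕ) :
    bimonomial x y (a + a') (b + b') = bimonomial x y a b * bimonomial x y a' b' := by
  classical
  simp only [bimonomial]
  rw [Finsupp.prod_add_index' (by simp) (by simp [pow_add]),
    Finsupp.prod_add_index' (by simp) (by simp [pow_add])]
  ring

theorem bimonomial_single_left (i : ι) : bimonomial x y (.single i 1) 0 = x i := by
  simp [bimonomial]

theorem bimonomial_single_right (i : ι) : bimonomial x y 0 (.single i 1) = y i := by
  simp [bimonomial]

theorem bimonomial_add_single_left (a b : ι →₀ ℕ) (i : ι) :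
    bimonomial x y (a + .single i 1) b = bimonomial x y a b * x i := by
  rw [← bimonomial_single_left (x := x) (y := y) i, ← bimonomial_add, add_zero]

theorem bimonomial_add_single_right (a b : ι →₀ ℕ) (i : ι) :
    bimonomial x y a (b + .single i 1) = bimonomial x y a b * y i := by
  rw [← bimonomial_single_right (x := x) (y := y) i, ← bimonomial_add, add_zero]

theorem Finsupp.exists_eq_add_single {a : ι →₀ ℕ} {i : ι} (h : a i ≠ 0) :
    ∃ a', a = a' + .single i 1 :=
  ⟨a - .single i 1, (tsub_add_cancel_of_le (by simpa using Nat.one_le_iff_ne_zero.mpr h)).symm⟩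

/-- If the `2 × 2` minors of `(x, y)` vanish, then `x ^ a * y ^ b` depends only on `a + b` and on
the degree of `b`. -/
theorem bimonomial_eq_of_minors (h : ∀ i j, x i * y j = x j * y i) {a b a' b' : ι →₀ ℕ}
    (hab : a + b = a' + b') (hb : b.degree = b'.degree) :
    bimonomial x y a b = bimonomial x y a' b' := by
  induction hn : (a + b).degree generalizing a b a' b' with
  | zero =>
    have h1 := hn
    rw [hab] at h1
    simp only [map_add, Nat.add_eq_zero_iff, Finsupp.degree_eq_zero_iff] at hn h1
    rw [hn.1, hn.2, h1.1, h1.2]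
  | succ n ih =>
    have hright {a b a' b' : ι →₀ ℕ} (hab : a + b = a' + b') (hb : b.degree = b'.degree)
        (hn : (a + b).degree = n + 1) (i : ι) (hi : b i ≠ 0) (hi' : b' i ≠ 0) :
        bimonomial x y a b = bimonomial x y a' b' := by
      obtain ⟨c, rfl⟩ := Finsupp.exists_eq_add_single hi
      obtain ⟨c', rfl⟩ := Finsupp.exists_eq_add_single hi'
      rw [bimonomial_add_single_right, bimonomial_add_single_right,
        ih (a := a) (b := c) (a' := a') (b' := c')]
      · rwa [← add_assoc, ← add_assoc, add_left_inj] at hab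
      · simpa using hb
      · simpa [← add_assoc] using hn
    by_cases hb0 : b = 0
    · have hb0' : b' = 0 := by
        rwa [hb0, map_zero, eq_comm, Finsupp.degree_eq_zero_iff] at hb
      subst hb0 hb0'
      simp_all
    by_cases hr : ∃ i, b i ≠ 0 ∧ b' i ≠ 0
    · obtain ⟨i, hi, hi'⟩ := hr
      exact hright hab hb hn i hi hi'
    · push Not at hr
      have hb0' : b' ≠ 0 := by
        rintro rfl
        exact hb0 (by simpa [Finsupp.degree_eq_zero_iff] using hb)
      obtain ⟨i, hi⟩ := Finsupp.ne_iff.mp hb0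
      obtain ⟨j, hj'⟩ := Finsupp.ne_iff.mp hb0'
      have hj : a j ≠ 0 := by
        have h1 := DFunLike.congr_fun hab j
        have h2 : b j = 0 := by by_contra h0; exact hj' (hr j h0)
        simp only [Finsupp.add_apply, Finsupp.coe_zero, Pi.zero_apply] at h1 hj'
        omega
      obtain ⟨c, rfl⟩ := Finsupp.exists_eq_add_single hi
      obtain ⟨d, rfl⟩ := Finsupp.exists_eq_add_single hj
      have hswap : bimonomial x y (d + .single j 1) (c + .single i 1) =
          bimonomial x y (d + .single i 1) (c + .single j 1) := by
        simp only [bimonomial_add_single_left, bimonomial_add_single_right]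
        linear_combination bimonomial x y d c * h j i
      rw [hswap]
      have hsum : d + .single i 1 + (c + .single j 1) = d + .single j 1 + (c + .single i 1) := by
        abel
      exact hright (hsum.trans hab) (by simpa using hb) (hsum ▸ hn) j (by simp) hj'

/-- The common value of `x ^ a * y ^ b` over all `a + b = c` with `b` of degree `n`. -/
noncomputable def segreMonomial (x y : ι → R) (n : ℕ) (c : ι →₀ ℕ) : R :=
  open Classical in
  if h : ∃ p : (ι →₀ ℕ) × (ι →₀ ℕ), p.1 + p.2 = c ∧ p.2.degree = n then
    bimonomial x y h.choose.1 h.choose.2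
  else 0

theorem segreMonomial_add (h : ∀ i j, x i * y j = x j * y i) (a b : ι →₀ ℕ) :
    segreMonomial x y b.degree (a + b) = bimonomial x y a b := by
  have hex : ∃ p : (ι →₀ ℕ) × (ι →₀ ℕ), p.1 + p.2 = a + b ∧ p.2.degree = b.degree :=
    ⟨(a, b), rfl, rfl⟩
  rw [segreMonomial, dif_pos hex]
  exact bimonomial_eq_of_minors h hex.choose_spec.1 hex.choose_spec.2

theorem segreMonomial_eq_zero {n : ℕ} {c : ι →₀ ℕ} (h : c.degree < n) :
    segreMonomial x y n c = 0 := by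
  rw [segreMonomial, dif_neg]
  rintro ⟨p, rfl, rfl⟩
  simp at h

theorem Finsupp.exists_add_eq_degree_eq {c : ι →₀ ℕ} {n : ℕ} (h : n ≤ c.degree) :
    ∃ a b : ι →₀ ℕ, a + b = c ∧ b.degree = n := by
  induction n with
  | zero => exact ⟨c, 0, by simp⟩
  | succ n ih =>
    obtain ⟨a, b, rfl, rfl⟩ := ih (by omega)
    have ha : a ≠ 0 := by rintro rfl; simp at h
    obtain ⟨i, hi⟩ := Finsupp.ne_iff.mp ha
    obtain ⟨d, rfl⟩ := Finsupp.exists_eq_add_single hi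
    exact ⟨d, b + .single i 1, by abel, by simp⟩

variable {k : Type*} [Field k] [Algebra k R]

variable (x y k) in
/-- The linear extension of `segreMonomial x y n`. -/
noncomputable def segreMap (n : ℕ) : MvPolynomial ι k →ₗ[k] R :=
  (basisMonomials ι k).constr k (segreMonomial x y n)

theorem segreMap_monomial (n : ℕ) (c : ι →₀ ℕ) :
    segreMap x y k n (monomial c 1) = segreMonomial x y n c := by
  simpa [segreMap] using (basisMonomials ι k).constr_basis k (segreMonomial x y n) c

/-- If the quadric `∑ i, v i * v (e i)` and its polarisation vanish on `(x, y)`, then `segreMap`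
vanishes on the multiples of this quadric. -/
theorem segreMap_quadric_mul [Fintype ι] (e : ι → ι) (h : ∀ i j, x i * y j = x j * y i)
    (hxx : ∑ i, x i * x (e i) = 0) (hxy : ∑ i, x i * y (e i) = 0) (hyy : ∑ i, y i * y (e i) = 0)
    (n : ℕ) (p : MvPolynomial ι k) :
    segreMap x y k n ((∑ i, X i * X (e i)) * p) = 0 := by
  induction p using MvPolynomial.induction_on' with
  | add p q hp hq => rw [mul_add, map_add, hp, hq, add_zero]
  | monomial c r =>
    have hmon (i : ι) : X i * X (e i) * monomial c r =
        r • (monomial (c + .single i 1 + .single (e i) 1) 1 : MvPolynomial ι k) := by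
      rw [X, X, monomial_mul, monomial_mul, smul_monomial,
        show c + .single i 1 + .single (e i) 1 = .single i 1 + .single (e i) 1 + c by abel]
      simp
    rw [Finset.sum_mul, map_sum]
    simp only [hmon, map_smul, segreMap_monomial]
    rw [← Finset.smul_sum]
    convert smul_zero r
    rcases Nat.lt_or_ge (c.degree + 2) n with hlt | hle
    · exact Finset.sum_eq_zero fun i _ ↦ segreMonomial_eq_zero (by simpa using hlt)
    obtain ⟨s, t, hs, hst⟩ : ∃ s t, s ≤ c.degree ∧ t ≤ 2 ∧ s + t = n :=
      ⟨min n c.degree, n - min n c.degree, by omega, by omega, by omega⟩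
    obtain ⟨ht, rfl⟩ := hst
    obtain ⟨a, b, rfl, rfl⟩ := Finsupp.exists_add_eq_degree_eq hs
    interval_cases t
    · have (i : ι) : segreMonomial x y (b.degree + 0) (a + b + .single i 1 + .single (e i) 1) =
          bimonomial x y a b * (x i * x (e i)) := by
        rw [show a + b + .single i 1 + .single (e i) 1 =
          (a + .single i 1 + .single (e i) 1) + b by abel, add_zero, segreMonomial_add h]
        simp only [bimonomial_add_single_left, mul_assoc]
      simp only [this, ← Finset.mul_sum, hxx, mul_zero]
    · have (i : ι) : segreMonomial x y (b.degree + 1) (a + b + .single i 1 + .single (e i) 1) =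
          bimonomial x y a b * (x i * y (e i)) := by
        rw [show a + b + .single i 1 + .single (e i) 1 =
            (a + .single i 1) + (b + .single (e i) 1) by abel,
          show b.degree + 1 = (b + .single (e i) 1).degree by simp, segreMonomial_add h]
        simp only [bimonomial_add_single_left, bimonomial_add_single_right, mul_assoc]
      simp only [this, ← Finset.mul_sum, hxy, mul_zero]
    · have (i : ι) : segreMonomial x y (b.degree + 2) (a + b + .single i 1 + .single (e i) 1) =
          bimonomial x y a b * (y i * y (e i)) := by
        rw [show a + b + .single i 1 + .single (e i) 1 =
            a + (b + .single i 1 + .single (e i) 1) by abel,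
          show b.degree + 2 = (b + .single i 1 + .single (e i) 1).degree by simp,
          segreMonomial_add h]
        simp only [bimonomial_add_single_right, mul_assoc]
      simp only [this, ← Finset.mul_sum, hyy, mul_zero]

variable (k ι) in
/-- The parametrisation `x i ↦ v i`, `y i ↦ v i * t` of the pairs of proportional vectors. -/
noncomputable def segreParam : MvPolynomial (ι ⊕ ι) k →ₐ[k] Polynomial (MvPolynomial ι k) :=
  aeval (Sum.elim (fun i ↦ .C (X i)) fun i ↦ .C (X i) * .X)

theorem segreParam_bimonomial (a b : ι →₀ ℕ) :
    segreParam ι k (bimonomial (fun i ↦ X (.inl i)) (fun i ↦ X (.inr i)) a b) =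
      Polynomial.monomial b.degree (monomial (a + b) 1) := by
  classical
  have hC (a : ι →₀ ℕ) : (a.prod fun i n ↦ (Polynomial.C (X i : MvPolynomial ι k)) ^ n) =
      Polynomial.C (monomial a 1) := by
    rw [monomial_eq, C_1, one_mul, Finsupp.prod, Finsupp.prod, map_prod]
    simp
  rw [bimonomial, map_mul, map_finsuppProd, map_finsuppProd]
  simp only [map_pow, segreParam, aeval_X, Sum.elim_inl, Sum.elim_inr, mul_pow]
  rw [Finsupp.prod_mul, hC, hC, Finsupp.prod, Finset.prod_pow_eq_pow_sum, ← mul_assoc, ← map_mul,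
    monomial_mul, one_mul, Polynomial.C_mul_X_pow_eq_monomial]
  rfl

theorem exists_monomial_eq_bimonomial (d : ι ⊕ ι →₀ ℕ) : ∃ a b : ι →₀ ℕ,
    (monomial d 1 : MvPolynomial (ι ⊕ ι) k) =
      bimonomial (fun i ↦ X (.inl i)) (fun i ↦ X (.inr i)) a b := by
  induction d using Finsupp.induction_linear with
  | zero => exact ⟨0, 0, by simp [bimonomial]⟩
  | add d d' h h' =>
    obtain ⟨a, b, h⟩ := h
    obtain ⟨a', b', h'⟩ := h'
    exact ⟨a + a', b + b', by rw [bimonomial_add, ← h, ← h', monomial_mul, one_mul]⟩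
  | single s n =>
    rcases s with i | i
    · exact ⟨.single i n, 0, by simp [bimonomial, X_pow_eq_monomial]⟩
    · exact ⟨0, .single i n, by simp [bimonomial, X_pow_eq_monomial]⟩

theorem lsum_segreMap_segreParam (h : ∀ i j, x i * y j = x j * y i) (f : MvPolynomial (ι ⊕ ι) k) :
    Polynomial.lsum (segreMap x y k) (segreParam ι k f) = aeval (Sum.elim x y) f := by
  classical
  induction f using MvPolynomial.induction_on' with
  | add p q hp hq => rw [map_add, map_add, map_add, hp, hq]
  | monomial d r =>
    obtain ⟨a, b, hd⟩ := exists_monomial_eq_bimonomial (k := k) d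
    rw [← mul_one r, ← smul_eq_mul, ← smul_monomial, hd, map_smul, map_smul, map_smul, segreParam_bimonomial]
    congr 1
    rw [Polynomial.lsum_apply, Polynomial.sum_monomial_index _ _ (by simp), segreMap_monomial,
      segreMonomial_add h]
    simp [bimonomial, map_finsuppProd]

/-- If `(x, y)` has vanishing minors and is isotropic for the quadric `∑ i, v i * v (e i)`, then
every relation that `segreParam` satisfies modulo this quadric also holds for `(x, y)`. -/
theorem aeval_eq_zero_of_dvd_segreParam [Fintype ι] (e : ι → ι) (h : ∀ i j, x i * y j = x j * y i)
    (hxx : ∑ i, x i * x (e i) = 0) (hxy : ∑ i, x i * y (e i) = 0) (hyy : ∑ i, y i * y (e i) = 0)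
    {f : MvPolynomial (ι ⊕ ι) k}
    (hf : Polynomial.C (∑ i, X i * X (e i)) ∣ segreParam ι k f) :
    aeval (Sum.elim x y) f = 0 := by
  obtain ⟨g, hg⟩ := hf
  rw [← lsum_segreMap_segreParam h, hg, Polynomial.lsum_apply, Polynomial.sum_def]
  refine Finset.sum_eq_zero fun n _ ↦ ?_
  rw [Polynomial.coeff_C_mul, segreMap_quadric_mul e h hxx hxy hyy]

end Bimonomial

section Quadric

theorem sum_mul_rev_eq {R : Type*} [CommRing R] {n : ℕ} (f : Fin (n + 3) → R) :
    ∑ i, f i * f i.rev = 2 * f (Fin.last _) * f 0 +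
      ∑ i : Fin (n + 1), f i.castSucc.succ * f i.rev.castSucc.succ := by
  rw [Fin.sum_univ_succ, Fin.sum_univ_castSucc]
  simp only [Fin.rev_zero, Fin.succ_last, Fin.rev_last, Fin.rev_succ, Fin.rev_castSucc,
    Fin.succ_castSucc]
  ring

variable {k : Type*} [Field k]

theorem irreducible_sum_X_mul_X_rev (h2 : (2 : k) ≠ 0) (n : ℕ) :
    Irreducible (∑ i : Fin (n + 3), X i * X i.rev : MvPolynomial (Fin (n + 3)) k) := by
  classical
  rw [sum_mul_rev_eq]
  set g : MvPolynomial (Fin (n + 3)) k :=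
    ∑ i : Fin (n + 1), X i.castSucc.succ * X i.rev.castSucc.succ with hg
  let v : Fin (n + 3) → k := fun i ↦
    if i = (0 : Fin (n + 1)).castSucc.succ ∨ i = (Fin.last n).castSucc.succ then 1 else 0
  have hv : eval v g ≠ 0 := by
    have : eval v g = ∑ i : Fin (n + 1), if i = 0 ∨ i = Fin.last n then 1 else 0 := by
      simp only [hg, map_sum, map_mul, eval_X]
      refine Finset.sum_congr rfl fun i _ ↦ ?_
      simp only [v, Fin.succ_inj, Fin.castSucc_inj, Fin.rev_eq_iff, Fin.rev_zero, Fin.rev_last]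
      split_ifs <;> simp_all
    rw [this]
    cases n with
    | zero => simp
    | succ n =>
      rw [Fin.sum_univ_succ, Fin.sum_univ_castSucc]
      have (i : Fin n) : ¬ (i.castSucc.succ = 0 ∨ i.castSucc.succ = Fin.last (n + 1)) := by
        simp [Fin.ext_iff]; omega
      simp only [this, if_false]
      simpa [one_add_one_eq_two] using h2
  have hC : (2 : MvPolynomial (Fin (n + 3)) k) = C 2 := (map_ofNat C 2).symm
  have hunit : IsUnit (2 : MvPolynomial (Fin (n + 3)) k) := hC ▸ (IsUnit.mk0 2 h2).map C
  refine irreducible_mul_X_add _ _ _ (mul_ne_zero hunit.ne_zero (X_ne_zero _)) ?_ ?_ ?_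
  · intro h
    have := vars_mul _ _ h
    rw [hC, vars_C, vars_X] at this
    simp [Fin.ext_iff] at this
  · intro h
    have := vars_sum_subset _ _ h
    simp only [Finset.mem_biUnion] at this
    obtain ⟨i, -, hi⟩ := this
    have := vars_mul _ _ hi
    rw [vars_X, vars_X, Finset.mem_union, Finset.mem_singleton, Finset.mem_singleton] at this
    exact this.elim (Fin.succ_ne_zero _).symm (Fin.succ_ne_zero _).symm
  · rw [isRelPrime_mul_unit_left_left hunit, (X_prime.irreducible).isRelPrime_iff_not_dvd]
    rintro ⟨p, hp⟩
    apply hv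
    rw [hp, map_mul, eval_X]
    simp [v, Fin.ext_iff]

end Quadric

section J2Ideal

variable {k : Type*} [Field k] {m : ℕ}

theorem J2Ideal_le_ker_aeval {T : Type*} [CommRing T] [Algebra k T] {x y : Fin m → T}
    (h : ∀ i j, x i * y j = x j * y i) (hxy : ∑ i, x i * y i.rev = 0)
    (hxx : ∑ i, x i * x i.rev = 0) (hyy : ∑ i, y i * y i.rev = 0) :
    J2Ideal k m ≤ RingHom.ker (aeval (R := k) (Sum.elim x y)) := by
  rw [J2Ideal, Ideal.span_le]
  rintro p (((⟨i, j, -, rfl⟩ | rfl) | rfl) | rfl)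
  · simp [xVar, yVar, h i j]
  · simpa [xVar, yVar] using hxy
  · simpa [xVar] using hxx
  · simpa [yVar] using hyy

/-- The class of `xᵢ` modulo `J₂`. -/
noncomputable def xBar (k : Type*) [Field k] (i : Fin m) :
    MvPolynomial (Fin m ⊕ Fin m) k ⧸ J2Ideal k m :=
  Ideal.Quotient.mk _ (xVar k i)

/-- The class of `yᵢ` modulo `J₂`. -/
noncomputable def yBar (k : Type*) [Field k] (i : Fin m) :
    MvPolynomial (Fin m ⊕ Fin m) k ⧸ J2Ideal k m :=
  Ideal.Quotient.mk _ (yVar k i)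

theorem xBar_mul_yBar_comm (i j : Fin m) : xBar k i * yBar k j = xBar k j * yBar k i := by
  wlog hij : i < j generalizing i j
  · rcases eq_or_lt_of_not_gt hij with rfl | h
    · rfl
    · exact (this j i h).symm
  simp only [xBar, yBar, ← map_mul]
  exact Ideal.Quotient.eq.mpr <| Ideal.subset_span <| .inl <| .inl <| .inl ⟨i, j, hij, rfl⟩

theorem sum_xBar_mul_yBar_rev : ∑ i : Fin m, xBar k i * yBar k i.rev = 0 := by
  simp only [xBar, yBar, ← map_mul, ← map_sum]
  exact Ideal.Quotient.eq_zero_iff_mem.mpr <| Ideal.subset_span <| .inl <| .inl <| .inr rfl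

theorem sum_xBar_mul_xBar_rev : ∑ i : Fin m, xBar k i * xBar k i.rev = 0 := by
  simp only [xBar, ← map_mul, ← map_sum]
  exact Ideal.Quotient.eq_zero_iff_mem.mpr <| Ideal.subset_span <| .inl <| .inr rfl

theorem sum_yBar_mul_yBar_rev : ∑ i : Fin m, yBar k i * yBar k i.rev = 0 := by
  simp only [yBar, ← map_mul, ← map_sum]
  exact Ideal.Quotient.eq_zero_iff_mem.mpr <| Ideal.subset_span <| .inr rfl

theorem aeval_xBar_yBar :
    aeval (Sum.elim (xBar k) (yBar k)) = Ideal.Quotient.mkₐ k (J2Ideal k m) := by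
  ext i
  rcases i with i | i <;> simp [xBar, yBar, xVar, yVar]

theorem J2Ideal_eq_comap_segreParam : J2Ideal k m =
    (Ideal.span {Polynomial.C (∑ i : Fin m, X i * X i.rev : MvPolynomial (Fin m) k)}).comap
      (segreParam (Fin m) k) := by
  apply le_antisymm
  · rw [J2Ideal, Ideal.span_le]
    have hx (i : Fin m) : segreParam (Fin m) k (xVar k i) = .C (X i) := by
      simp [segreParam, xVar]
    have hy (i : Fin m) : segreParam (Fin m) k (yVar k i) = .C (X i) * .X := by
      simp [segreParam, yVar]
    intro p hp
    rw [SetLike.mem_coe, Ideal.mem_comap, Ideal.mem_span_singleton]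
    rcases hp with ((⟨i, j, -, rfl⟩ | rfl) | rfl) | rfl
    · rw [map_sub, map_mul, map_mul, hx, hx, hy, hy]
      exact Dvd.intro 0 (by ring)
    · refine Dvd.intro .X ?_
      simp only [map_sum, map_mul, hx, hy, Finset.sum_mul, mul_assoc]
    · refine Dvd.intro 1 ?_
      simp only [map_sum, map_mul, hx, mul_one]
    · refine Dvd.intro (.X * .X) ?_
      simp only [map_sum, map_mul, hy, Finset.sum_mul]
      exact Finset.sum_congr rfl fun i _ ↦ by ring
  · intro f hf
    have := aeval_eq_zero_of_dvd_segreParam (x := xBar k) (y := yBar k) Fin.rev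
      xBar_mul_yBar_comm sum_xBar_mul_xBar_rev sum_xBar_mul_yBar_rev sum_yBar_mul_yBar_rev
      (Ideal.mem_span_singleton.mp hf)
    rwa [aeval_xBar_yBar, Ideal.Quotient.mkₐ_eq_mk, Ideal.Quotient.eq_zero_iff_mem] at this

theorem J2Ideal_isPrime (h2 : (2 : k) ≠ 0) (n : ℕ) : (J2Ideal k (n + 3)).IsPrime := by
  have hq := Polynomial.prime_C_iff.mpr (irreducible_sum_X_mul_X_rev h2 n).prime
  have := (Ideal.span_singleton_prime hq.ne_zero).mpr hq
  rw [J2Ideal_eq_comap_segreParam]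
  exact Ideal.comap_isPrime _ _

/-- The family `(y_m, x_2, …, x_m)` in the quotient by `J₂`. -/
noncomputable def paramBar (k : Type*) [Field k] (n : ℕ) :
    Fin (n + 3) → MvPolynomial (Fin (n + 3) ⊕ Fin (n + 3)) k ⧸ J2Ideal k (n + 3) :=
  Fin.cons (yBar k (Fin.last _)) fun i ↦ xBar k i.succ

theorem algebraicIndependent_paramBar (h2 : (2 : k) ≠ 0) (n : ℕ) :
    AlgebraicIndependent k (paramBar k n) := by
  let F := FractionRing (MvPolynomial (Fin (n + 3)) k)
  let z : Fin (n + 3) → F := fun i ↦ algebraMap (MvPolynomial (Fin (n + 3)) k) F (X i)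
  have hinj : Function.Injective (algebraMap (MvPolynomial (Fin (n + 3)) k) F) :=
    IsFractionRing.injective _ _
  have hz : z (Fin.last _) ≠ 0 := fun h ↦ X_ne_zero (R := k) (Fin.last (n + 2))
    (hinj (h.trans (map_zero _).symm))
  have h2F : (2 : F) ≠ 0 := by
    rw [← map_ofNat (algebraMap k F) 2]
    exact (map_ne_zero (algebraMap k F)).mpr h2
  let x : Fin (n + 3) → F := Fin.cons
    (-(∑ i : Fin (n + 1), z i.castSucc.succ * z i.rev.castSucc.succ) / (2 * z (Fin.last _)))
    fun i ↦ z i.succ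
  have hxs (i : Fin (n + 2)) : x i.succ = z i.succ := rfl
  have hxl : x (Fin.last _) = z (Fin.last _) := hxs (Fin.last _)
  have hx : ∑ i, x i * x i.rev = 0 := by
    rw [sum_mul_rev_eq, hxl]
    simp only [hxs]
    rw [show x 0 = -_ / _ from rfl, mul_div_cancel₀ _ (mul_ne_zero h2F hz), neg_add_cancel]
  let t : F := z 0 / z (Fin.last _)
  have hle : J2Ideal k (n + 3) ≤ RingHom.ker (aeval (R := k) (Sum.elim x fun i ↦ x i * t)) := by
    refine J2Ideal_le_ker_aeval (fun i j ↦ by ring) ?_ hx ?_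
    · simp only [← mul_assoc, ← Finset.sum_mul, hx, zero_mul]
    · simp only [mul_mul_mul_comm _ t, ← Finset.sum_mul, hx, zero_mul]
  refine AlgebraicIndependent.of_comp (Ideal.Quotient.liftₐ _ _ hle) ?_
  have hcomp : Ideal.Quotient.liftₐ _ _ hle ∘ paramBar k n =
      Algebra.algHom k (MvPolynomial (Fin (n + 3)) k) F ∘ X := by
    funext i
    refine Fin.cases ?_ (fun i ↦ ?_) i
    · exact (aeval_X _ _).trans ((congrArg (· * t) hxl).trans (mul_div_cancel₀ _ hz))
    · exact aeval_X _ _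
  rw [hcomp]
  exact (algebraicIndependent_X _ _).map' hinj

theorem isTranscendenceBasis_paramBar (h2 : (2 : k) ≠ 0) (n : ℕ) :
    IsTranscendenceBasis k (paramBar k n) := by
  have hind := algebraicIndependent_paramBar h2 n
  have := J2Ideal_isPrime h2 n
  rw [hind.isTranscendenceBasis_iff_isAlgebraic]
  let A := Algebra.adjoin k (Set.range (paramBar k n))
  have hparam (i) : IsAlgebraic A (paramBar k n i) :=
    isAlgebraic_algebraMap (⟨_, Algebra.subset_adjoin ⟨i, rfl⟩⟩ : A)
  have hxs (i : Fin (n + 2)) : IsAlgebraic A (xBar k i.succ) := hparam i.succ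
  have hyl : IsAlgebraic A (yBar k (Fin.last (n + 2))) := hparam 0
  have hxl : IsAlgebraic A (xBar k (Fin.last (n + 2))) := hxs (Fin.last _)
  have hl0 : xBar k (Fin.last (n + 2)) ∈ nonZeroDivisors _ :=
    mem_nonZeroDivisors_of_ne_zero (hind.ne_zero (Fin.last _))
  have hx (i : Fin (n + 3)) : IsAlgebraic A (xBar k i) := by
    refine Fin.cases ?_ hxs i
    refine .of_mul hl0 hxl ?_
    have h := sum_xBar_mul_xBar_rev (k := k) (m := n + 3)
    rw [sum_mul_rev_eq, mul_assoc, add_eq_zero_iff_eq_neg] at h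
    refine .of_mul (y := algebraMap k _ 2) (mem_nonZeroDivisors_of_ne_zero ?_)
      (isAlgebraic_algebraMap (algebraMap k A 2)) ?_
    · exact (map_ne_zero (algebraMap k _)).mpr h2
    · rw [map_ofNat, h]
      exact neg_mem (S := Subalgebra A _) (s := Subalgebra.algebraicClosure A _)
        (sum_mem fun i _ ↦ (hxs _).mul (hxs _))
  have hy (i : Fin (n + 3)) : IsAlgebraic A (yBar k i) := by
    refine .of_mul hl0 hxl ?_
    rw [xBar_mul_yBar_comm]
    exact (hx i).mul hyl
  refine ⟨fun r ↦ ?_⟩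
  obtain ⟨f, rfl⟩ := Ideal.Quotient.mkₐ_surjective k _ r
  rw [← aeval_xBar_yBar]
  induction f using MvPolynomial.induction_on with
  | C a =>
    rw [aeval_C]
    exact isAlgebraic_algebraMap (algebraMap k A a)
  | add p q hp hq =>
    rw [map_add]
    exact hp.add hq
  | mul_X p i hp =>
    rw [map_mul, aeval_X]
    exact hp.mul (i.rec hx hy)

end J2Ideal

/-- `J₂` is prime and `k[x,y]/J₂` has Krull dimension `m`. -/
theorem J2_prime_and_dim (k : Type*) [Field k] [IsAlgClosed k] (hchar : (2 : k) ≠ 0)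
    (m : ℕ) (hm : 3 ≤ m) :
    (J2Ideal k m).IsPrime ∧
      ringKrullDim (MvPolynomial (Fin m ⊕ Fin m) k ⧸ J2Ideal k m) = m := by
  obtain ⟨n, rfl⟩ := Nat.exists_eq_add_of_le' hm
  have := J2Ideal_isPrime hchar n
  refine ⟨this, ?_⟩
  rw [(isTranscendenceBasis_paramBar hchar n).ringKrullDim_eq, Nat.card_fin]
end

section
/- There is an isomorphism of R-algebras R[v, z, t_2,…,t_m]/(v·z·q − r) ≅ R[a, b, c, s_2,…,s_{m−1}]/(a·b·c − r), where q = 2t_m + Σ_{i=2}^{m−1} t_i t_{m+1−i}. (This is the chart computation in the proof of Proposition 7.1: each affine chart D_+(t) of the blow-up M^bl_I of the splitting model along τ^{−1}(worst point) is, up to a polynomial-ring factor, the standard semi-stable ring with equation a·b·c = 2π; in particular M^bl_I is covered by opens smooth over Spec O[u,x,y]/(uxy − 2π).) -/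
/-!
STATEMENT 6: There is an `R`-algebra isomorphism
`R[v,z,t₂,…,tₘ]/(v·z·q − r) ≅ R[a,b,c,s₂,…,s_{m−1}]/(a·b·c − r)`,
where `q = 2tₘ + Σ_{i=2}^{m−1} tᵢ t_{m+1−i}`.  Both sides are polynomial rings in `m+1`
variables, modeled on `MvPolynomial (Fin (m+1)) R`: on the left `v = X 0`, `z = X 1`,
`tᵢ = X i` for `2 ≤ i ≤ m`; on the right `a = X 0`, `b = X 1`, `c = X 2`, and
`sᵢ = X (i+1)` for `2 ≤ i ≤ m−1` are the remaining free variables.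
-/

open MvPolynomial

/-- The polynomial `q = 2tₘ + Σ_{i=2}^{m−1} tᵢ t_{m+1−i}` in `R[v,z,t₂,…,tₘ]`,
where `tᵢ = X i` in `MvPolynomial (Fin (m+1)) R`. -/
noncomputable def qPoly (R : Type*) [CommRing R] (m : ℕ) : MvPolynomial (Fin (m + 1)) R :=
  2 * X ⟨m, Nat.lt_succ_self m⟩ +
    ∑ i ∈ (Finset.Ico 2 m).attach,
      X (⟨i.1, by have h := i.2; rw [Finset.mem_Ico] at h; omega⟩ : Fin (m + 1)) *
        X (⟨m + 1 - i.1, by have h := i.2; rw [Finset.mem_Ico] at h; omega⟩ : Fin (m + 1))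

namespace MvPolynomial

variable {σ R : Type*} [CommRing R]

/-- Two algebra maps that agree on the variables in `s` agree on polynomials supported in `s`. -/
lemma algHom_eq_of_mem_supported {A : Type*} [CommRing A] [Algebra R A] {s : Set σ}
    {f g : MvPolynomial σ R →ₐ[R] A} (h : ∀ i ∈ s, f (X i) = g (X i))
    {p : MvPolynomial σ R} (hp : p ∈ supported R s) : f p = g p := by
  refine AlgHom.adjoin_le_equalizer f g ?_ hp
  rintro _ ⟨i, hi, rfl⟩
  exact h i hi

variable [DecidableEq σ]

lemma bind₁_update_X_of_mem_supported {k : σ} (y : MvPolynomial σ R) {p : MvPolynomial σ R}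
    (hp : p ∈ supported R {k}ᶜ) : bind₁ (Function.update X k y) p = p := by
  refine algHom_eq_of_mem_supported (g := AlgHom.id R _) (fun i hi => ?_) hp
  simp [Function.update_of_ne (show i ≠ k from hi)]

/-- The triangular automorphism `X k ↦ u * X k + p`, where `u` is a unit of `R` and `p` does not
involve `X k`; it fixes all the other variables. -/
noncomputable def triangularEquiv (k : σ) (u : Rˣ) (p : MvPolynomial σ R)
    (hp : p ∈ supported R {k}ᶜ) : MvPolynomial σ R ≃ₐ[R] MvPolynomial σ R :=
  AlgEquiv.ofAlgHom
    (aeval (Function.update X k (C (u : R) * X k + p)))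
    (aeval (Function.update X k (C (↑u⁻¹ : R) * (X k - p))))
    (by
      ext1 i
      rcases eq_or_ne i k with rfl | hi
      · simp [algHom_C, bind₁_update_X_of_mem_supported _ hp, ← mul_assoc, ← C_mul]
      · simp [Function.update_of_ne hi])
    (by
      ext1 i
      rcases eq_or_ne i k with rfl | hi
      · simp [algHom_C, bind₁_update_X_of_mem_supported _ hp, ← mul_assoc, ← C_mul]
      · simp [Function.update_of_ne hi])

lemma triangularEquiv_X_self (k : σ) (u : Rˣ) (p : MvPolynomial σ R)
    (hp : p ∈ supported R {k}ᶜ) : triangularEquiv k u p hp (X k) = C (u : R) * X k + p := by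
  simp [triangularEquiv]

lemma triangularEquiv_X_of_ne {k i : σ} (hi : i ≠ k) (u : Rˣ) (p : MvPolynomial σ R)
    (hp : p ∈ supported R {k}ᶜ) : triangularEquiv k u p hp (X i) = X i := by
  simp [triangularEquiv, Function.update_of_ne hi]

end MvPolynomial

/-- Some automorphism of the polynomial ring fixes `X 0` and `X 1` and sends `X 2` to `q`. -/
lemma exists_algEquiv_X_two_eq_qPoly {R : Type*} [CommRing R] (h2 : IsUnit (2 : R))
    (m : ℕ) (hm : 2 ≤ m) :
    ∃ e : MvPolynomial (Fin (m + 1)) R ≃ₐ[R] MvPolynomial (Fin (m + 1)) R,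
      e (X 0) = X 0 ∧ e (X 1) = X 1 ∧ e (X 2) = qPoly R m := by
  obtain ⟨u, hu⟩ := h2
  obtain ⟨n, rfl⟩ := Nat.exists_eq_add_of_le' hm
  have h02 : (0 : Fin (n + 2 + 1)) ≠ 2 := by
    simp [Fin.ext_iff, Nat.mod_eq_of_lt (show 2 < n + 2 + 1 by omega)]
  have h12 : (1 : Fin (n + 2 + 1)) ≠ 2 := by
    simp [Fin.ext_iff, Nat.mod_eq_of_lt (show 2 < n + 2 + 1 by omega)]
  have h0l : (0 : Fin (n + 2 + 1)) ≠ Fin.last (n + 2) := by simp [Fin.ext_iff]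
  have h1l : (1 : Fin (n + 2 + 1)) ≠ Fin.last (n + 2) := by simp [Fin.ext_iff]
  have hX {i : Fin (n + 2 + 1)} (hi : i ≠ Fin.last (n + 2)) :
      (X i : MvPolynomial (Fin (n + 2 + 1)) R) ∈ supported R {Fin.last (n + 2)}ᶜ :=
    Algebra.subset_adjoin ⟨i, hi, rfl⟩
  refine ⟨(renameEquiv R (Equiv.swap 2 (Fin.last (n + 2)))).trans
    (triangularEquiv (Fin.last (n + 2)) u _
      (sum_mem (t := (Finset.Ico 2 (n + 2)).attach) fun i _ => mul_mem
        (hX (i := ⟨i.1, by have h := i.2; rw [Finset.mem_Ico] at h; omega⟩) ?_)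
        (hX (i := ⟨n + 2 + 1 - i.1, by have h := i.2; rw [Finset.mem_Ico] at h; omega⟩) ?_))),
    ?_, ?_, ?_⟩
  · have h := Finset.mem_Ico.1 i.2
    simp only [ne_eq, Fin.ext_iff, Fin.val_last]
    omega
  · have h := Finset.mem_Ico.1 i.2
    simp only [ne_eq, Fin.ext_iff, Fin.val_last]
    omega
  · simp [Equiv.swap_apply_of_ne_of_ne h02 h0l, triangularEquiv_X_of_ne h0l]
  · simp [Equiv.swap_apply_of_ne_of_ne h12 h1l, triangularEquiv_X_of_ne h1l]
  · simp [triangularEquiv_X_self, hu, qPoly, Fin.last, map_ofNat C 2]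

/-- Each blow-up chart of `M^bl_I` is, up to a polynomial factor, the standard
semi-stable ring with equation `a·b·c = r`. -/
theorem blowup_chart_iso (R : Type*) [CommRing R] (h2 : IsUnit (2 : R)) (r : R)
    (m : ℕ) (hm : 2 ≤ m) :
    Nonempty
      ((MvPolynomial (Fin (m + 1)) R ⧸
          Ideal.span {X (0 : Fin (m + 1)) * X 1 * qPoly R m - C r}) ≃ₐ[R]
        (MvPolynomial (Fin (m + 1)) R ⧸
          Ideal.span {X (0 : Fin (m + 1)) * X 1 * X 2 - C r})) := by
  obtain ⟨e, he0, he1, he2⟩ := exists_algEquiv_X_two_eq_qPoly h2 m hm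
  refine ⟨(Ideal.quotientEquivAlg _ _ e ?_).symm⟩
  have hC : e (C r) = C r := e.commutes r
  simp [Ideal.map_span, he0, he1, he2, hC]
end
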